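/- arXiv:1302.3727 — 6 statements merged into one kernel-verified Lean document; each statement's English description precedes it below -/
import Mathlib

section
/- Let δ ∈ ℝ. Call δ critical if there exist nonnegative half-integers l < k with α_k(δ) = α_l(δ). Then the set of critical values of δ is exactly { (k+l)/2 : k,l ∈ ℕ, l < k } ∪ { (k² − l² + 1/4)/(2(k−l)) : k ∈ ℕ, l ∈ ℕ + 1/2, l < k } ∪ { (k² − l² − 1/4)/(2(k−l)) : k ∈ ℕ + 1/2, l ∈ ℕ, l < k }. -/
/-- The Casimir eigenvalue `α_k(δ)` on symbols of degree `k = n/2`, for `n : ℕ`: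
`α_k(δ) = (δ - k)²` if `k` is an integer (`n` even), and
`α_k(δ) = (δ - k)² - 1/4` if `k ∈ ℕ + 1/2` (`n` odd). -/
noncomputable def alphaHalfInt (δ : ℝ) (n : ℕ) : ℝ :=
  if Even n then (δ - (n : ℝ) / 2) ^ 2 else (δ - (n : ℝ) / 2) ^ 2 - 1 / 4

theorem alphaHalfInt_two_mul (δ : ℝ) (k : ℕ) : alphaHalfInt δ (2 * k) = (δ - k) ^ 2 := by
  rw [alphaHalfInt, if_pos (even_two_mul k)]
  push_cast
  ring

theorem alphaHalfInt_two_mul_add_one (δ : ℝ) (k : ℕ) :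
    alphaHalfInt δ (2 * k + 1) = (δ - (k + 1 / 2)) ^ 2 - 1 / 4 := by
  rw [alphaHalfInt, if_neg (Nat.not_even_two_mul_add_one k)]
  push_cast
  ring

theorem sub_sq_eq_sub_sq_sub_iff {x y : ℝ} (h : y < x) (c δ : ℝ) :
    (δ - x) ^ 2 = (δ - y) ^ 2 - c ↔ δ = (x ^ 2 - y ^ 2 + c) / (2 * (x - y)) := by
  rw [eq_div_iff (mul_pos two_pos (sub_pos.mpr h)).ne']
  constructor <;> intro hδ <;> linarith

/-- The set of critical values of `δ` (those for which `α_k(δ) = α_l(δ)` for some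
nonnegative half-integers `l < k`) is exactly
`{(k+l)/2 : k,l ∈ ℕ, l < k} ∪ {(k² − l² + 1/4)/(2(k−l)) : k ∈ ℕ, l ∈ ℕ + 1/2, l < k}
∪ {(k² − l² − 1/4)/(2(k−l)) : k ∈ ℕ + 1/2, l ∈ ℕ, l < k}`. -/
theorem critical_values_characterization :
    {δ : ℝ | ∃ n m : ℕ, m < n ∧ alphaHalfInt δ n = alphaHalfInt δ m} =
      {δ : ℝ | ∃ k l : ℕ, l < k ∧ δ = ((k : ℝ) + (l : ℝ)) / 2} ∪
      {δ : ℝ | ∃ k m : ℕ, (m : ℝ) + 1 / 2 < (k : ℝ) ∧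
        δ = ((k : ℝ) ^ 2 - ((m : ℝ) + 1 / 2) ^ 2 + 1 / 4) /
            (2 * ((k : ℝ) - ((m : ℝ) + 1 / 2)))} ∪
      {δ : ℝ | ∃ m l : ℕ, (l : ℝ) < (m : ℝ) + 1 / 2 ∧
        δ = (((m : ℝ) + 1 / 2) ^ 2 - (l : ℝ) ^ 2 - 1 / 4) /
            (2 * (((m : ℝ) + 1 / 2) - (l : ℝ)))} := by
  ext δ
  simp only [Set.mem_union, Set.mem_ofPred_eq]
  constructor
  · rintro ⟨n, m, hmn, h⟩
    obtain ⟨k, rfl | rfl⟩ := n.even_or_odd' <;> obtain ⟨l, rfl | rfl⟩ := m.even_or_odd' <;>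
      simp only [alphaHalfInt_two_mul, alphaHalfInt_two_mul_add_one] at h
    · have hlk : l < k := by lia
      have hpos : (k : ℝ) - l ≠ 0 := (sub_pos.mpr (Nat.cast_lt.mpr hlk)).ne'
      refine Or.inl (Or.inl ⟨k, l, hlk, mul_left_cancel₀ hpos ?_⟩)
      linarith
    · have hlt : (l : ℝ) + 1 / 2 < k := by
        have : ((2 * l + 1 : ℕ) : ℝ) < (2 * k : ℕ) := Nat.cast_lt.mpr hmn
        push_cast at this
        linarith
      exact Or.inl (Or.inr ⟨k, l, hlt, (sub_sq_eq_sub_sq_sub_iff hlt _ _).mp h⟩)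
    · have hlt : (l : ℝ) < k + 1 / 2 := by
        have : ((2 * l : ℕ) : ℝ) < (2 * k + 1 : ℕ) := Nat.cast_lt.mpr hmn
        push_cast at this
        linarith
      refine Or.inr ⟨k, l, hlt, ?_⟩
      rw [sub_eq_add_neg _ (1 / 4 : ℝ), ← sub_sq_eq_sub_sq_sub_iff hlt]
      linarith
    · have hlk : l < k := by lia
      have hpos : (k : ℝ) - l ≠ 0 := (sub_pos.mpr (Nat.cast_lt.mpr hlk)).ne'
      refine Or.inl (Or.inl ⟨k + 1, l, by lia, mul_left_cancel₀ hpos ?_⟩)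
      push_cast
      linarith
  · rintro ((⟨k, l, hlk, rfl⟩ | ⟨k, l, hlt, h⟩) | ⟨k, l, hlt, h⟩)
    · refine ⟨2 * k, 2 * l, by lia, ?_⟩
      rw [alphaHalfInt_two_mul, alphaHalfInt_two_mul]
      ring
    · refine ⟨2 * k, 2 * l + 1, ?_, ?_⟩
      · rw [← Nat.cast_lt (α := ℝ)]
        push_cast
        linarith
      · rw [alphaHalfInt_two_mul, alphaHalfInt_two_mul_add_one]
        exact (sub_sq_eq_sub_sq_sub_iff hlt _ _).mpr h
    · refine ⟨2 * k + 1, 2 * l, ?_, ?_⟩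
      · rw [← Nat.cast_lt (α := ℝ)]
        push_cast
        linarith
      · rw [alphaHalfInt_two_mul, alphaHalfInt_two_mul_add_one]
        rw [sub_eq_add_neg _ (1 / 4 : ℝ), ← sub_sq_eq_sub_sq_sub_iff hlt] at h
        linarith
end

section
/- Fix λ, δ ∈ ℝ and an integer k ≥ 1, and suppose α_k(δ) ≠ α_{k−1/2}(δ), α_k(δ) ≠ α_{k−l−1/2}(δ), and α_k(δ) ≠ α_{k−i}(δ) for all integers 1 ≤ i ≤ l. Then for every integer l with 1 ≤ l ≤ k − 1, the coefficients satisfy the recursion E_{l+1/2} = (A_{k−l} B_{k−l} / (2(α_k(δ) − α_{k−l−1/2}(δ)))) · (C_l + 2 D_l + 2 E_{l−1/2}). -/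
noncomputable section

/-- `α` at an integer point `t`: `(δ - t)²`. -/
def aI (δ t : ℝ) : ℝ := (δ - t) ^ 2

/-- `α` at a half-odd-integer point `t`: `(δ - t)² - 1/4`. -/
def aH (δ t : ℝ) : ℝ := (δ - t) ^ 2 - 1 / 4

/-- `A_j = -j`. -/
def Acoef (j : ℝ) : ℝ := -j

/-- `B_j = -(j + 2λ)`. -/
def Bcoef (lam j : ℝ) : ℝ := -(j + 2 * lam)

/-- `∏_{i=1}^{m} A_{k-i} B_{k-i}` (empty product = 1). -/
def prodAB (lam k : ℝ) (m : ℕ) : ℝ :=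
  ∏ i ∈ Finset.range m, (Acoef (k - ((i : ℝ) + 1)) * Bcoef lam (k - ((i : ℝ) + 1)))

/-- `∏_{i=1}^{m} (α_k(δ) - α_{k-i}(δ))` (empty product = 1). -/
def prodAlpha (δ k : ℝ) (m : ℕ) : ℝ :=
  ∏ i ∈ Finset.range m, (aI δ k - aI δ (k - ((i : ℝ) + 1)))

/-- `C_l = (∏_{i=1}^{l−1} A_{k−i} B_{k−i}) / (∏_{i=1}^{l} (α_k − α_{k−i}))`. -/
def Ccoef (lam δ k : ℝ) (l : ℕ) : ℝ := prodAB lam k (l - 1) / prodAlpha δ k l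

/-- `D_l = −l (∏_{i=1}^{l−1} A_{k−i} B_{k−i}) / (2(α_k − α_{k−1/2}) ∏_{i=1}^{l} (α_k − α_{k−i}))`. -/
def Dcoef (lam δ k : ℝ) (l : ℕ) : ℝ :=
  -(l : ℝ) * prodAB lam k (l - 1) /
    (2 * (aI δ k - aH δ (k - 1 / 2)) * prodAlpha δ k l)

/-- `E_{m+1/2} = (∏_{i=1}^{m} A_{k−i} B_{k−i}) / (2(α_k − α_{k−1/2}) ∏_{i=1}^{m} (α_k − α_{k−i}))`. -/
def Ecoef (lam δ k : ℝ) (m : ℕ) : ℝ :=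
  prodAB lam k m / (2 * (aI δ k - aH δ (k - 1 / 2)) * prodAlpha δ k m)

end

/-- Recursion for the `E` coefficients:
`E_{l+1/2} = (A_{k−l} B_{k−l} / (2(α_k − α_{k−l−1/2}))) (C_l + 2 D_l + 2 E_{l−1/2})`. -/
theorem Ecoef_recursion (lam δ : ℝ) (k : ℕ) (hk : 1 ≤ k)
    (l : ℕ) (hl1 : 1 ≤ l) (hl2 : l ≤ k - 1)
    (h1 : aI δ (k : ℝ) ≠ aH δ ((k : ℝ) - 1 / 2))
    (h2 : aI δ (k : ℝ) ≠ aH δ ((k : ℝ) - (l : ℝ) - 1 / 2))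
    (h3 : ∀ i : ℕ, 1 ≤ i → i ≤ l → aI δ (k : ℝ) ≠ aI δ ((k : ℝ) - (i : ℝ))) :
    Ecoef lam δ (k : ℝ) l =
      Acoef ((k : ℝ) - (l : ℝ)) * Bcoef lam ((k : ℝ) - (l : ℝ)) /
        (2 * (aI δ (k : ℝ) - aH δ ((k : ℝ) - (l : ℝ) - 1 / 2))) *
      (Ccoef lam δ (k : ℝ) l + 2 * Dcoef lam δ (k : ℝ) l + 2 * Ecoef lam δ (k : ℝ) (l - 1)) := by
  obtain ⟨n, rfl⟩ : ∃ n, l = n + 1 := ⟨l - 1, by omega⟩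
  have hQ : prodAlpha δ k n ≠ 0 := by
    refine Finset.prod_ne_zero_iff.mpr fun i hi => sub_ne_zero.mpr ?_
    have := h3 (i + 1) (by omega) (by have := Finset.mem_range.mp hi; omega)
    simpa using this
  have hq : aI δ k - aI δ ((k : ℝ) - ((n : ℝ) + 1)) ≠ 0 :=
    sub_ne_zero.mpr (by simpa using h3 (n + 1) (by omega) le_rfl)
  have ha := sub_ne_zero.mpr h1
  have hb := sub_ne_zero.mpr h2
  have hAB : prodAB lam k (n + 1) = prodAB lam k n *
      (Acoef ((k : ℝ) - ((n : ℝ) + 1)) * Bcoef lam ((k : ℝ) - ((n : ℝ) + 1))) :=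
    Finset.prod_range_succ _ _
  have hAlpha : prodAlpha δ k (n + 1) =
      prodAlpha δ k n * (aI δ k - aI δ ((k : ℝ) - ((n : ℝ) + 1))) :=
    Finset.prod_range_succ _ _
  have key : aI δ k - aH δ ((k : ℝ) - ((n + 1 : ℕ) : ℝ) - 1 / 2) =
      (aI δ k - aH δ ((k : ℝ) - 1 / 2)) - ((n : ℝ) + 1) +
        (aI δ k - aI δ ((k : ℝ) - ((n : ℝ) + 1))) := by
    simp only [aI, aH]
    push_cast
    ring
  simp only [Ecoef, Ccoef, Dcoef, Nat.add_sub_cancel, hAB, hAlpha]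
  rw [key] at hb ⊢
  push_cast
  generalize aI δ k - aH δ ((k : ℝ) - 1 / 2) = a at *
  generalize aI δ k - aI δ ((k : ℝ) - ((n : ℝ) + 1)) = q at *
  generalize prodAlpha δ k n = Q at *
  field_simp
  ring
end

section
/- Fix λ, δ ∈ ℝ and an integer k ≥ 1, and suppose α_k(δ) ≠ α_{k−1/2}(δ) and α_k(δ) ≠ α_{k−i}(δ) for all integers 1 ≤ i ≤ m + 1. Then for every integer m with 1 ≤ m ≤ k − 1, the coefficients satisfy the recursion D_{m+1} = (−E_{m+1/2} + A_{k−m} B_{k−m} D_m) / (α_k(δ) − α_{k−m−1}(δ)). -/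
/-- Splitting off the last factor of `prodAB`. -/
theorem prodAB_succ (lam k : ℝ) (m : ℕ) :
    prodAB lam k (m + 1) =
      prodAB lam k m * (Acoef (k - ((m : ℝ) + 1)) * Bcoef lam (k - ((m : ℝ) + 1))) :=
  Finset.prod_range_succ _ _

/-- Splitting off the last factor of `prodAlpha`. -/
theorem prodAlpha_succ (δ k : ℝ) (m : ℕ) :
    prodAlpha δ k (m + 1) = prodAlpha δ k m * (aI δ k - aI δ (k - ((m : ℝ) + 1))) :=
  Finset.prod_range_succ _ _

/-- Recursion for the `D` coefficients:
`D_{m+1} = (−E_{m+1/2} + A_{k−m} B_{k−m} D_m) / (α_k − α_{k−m−1})`. -/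
theorem Dcoef_recursion (lam δ : ℝ) (k : ℕ) (hk : 1 ≤ k)
    (m : ℕ) (hm1 : 1 ≤ m) (hm2 : m ≤ k - 1)
    (h1 : aI δ (k : ℝ) ≠ aH δ ((k : ℝ) - 1 / 2))
    (h2 : ∀ i : ℕ, 1 ≤ i → i ≤ m + 1 → aI δ (k : ℝ) ≠ aI δ ((k : ℝ) - (i : ℝ))) :
    Dcoef lam δ (k : ℝ) (m + 1) =
      (-(Ecoef lam δ (k : ℝ) m) +
        Acoef ((k : ℝ) - (m : ℝ)) * Bcoef lam ((k : ℝ) - (m : ℝ)) * Dcoef lam δ (k : ℝ) m) /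
      (aI δ (k : ℝ) - aI δ ((k : ℝ) - (m : ℝ) - 1)) := by
  obtain ⟨n, rfl⟩ := Nat.exists_eq_add_of_le' hm1
  have shift : (k : ℝ) - ((n + 1 : ℕ) : ℝ) - 1 = k - (((n + 1 : ℕ) : ℝ) + 1) := by ring
  rw [shift]
  simp only [Dcoef, Ecoef, Nat.add_sub_cancel, prodAlpha_succ δ k (n + 1), prodAB_succ]
  generalize aI δ (k : ℝ) - aI δ (k - (((n + 1 : ℕ) : ℝ) + 1)) = q
  generalize prodAlpha δ k (n + 1) = Q
  generalize aI δ (k : ℝ) - aH δ (k - 1 / 2) = c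
  push_cast
  ring
end

section
/- Let f be any one of the eight contact Hamiltonians 1, x, θ₁, θ₂, θ₁θ₂, x², xθ₁, xθ₂ (each homogeneous in A, of parity f̃). Then for every natural number k ≥ 1, as operators on A, [X_f, ∂ₓ^k] = −k f′ ∂ₓ^k + (k(−1)^{f̃}/2)(D̄₁(f′) ∂ₓ^{k−1} D̄₁ + D̄₂(f′) ∂ₓ^{k−1} D̄₂) − (k(k−1)/2) f″ ∂ₓ^{k−1}, where f′ = ∂ₓ(f), f″ = ∂ₓ²(f), superfunctions act by left multiplication, and the commutator is the ordinary one (∂ₓ^k is even). -/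
/-! Model of the superfunctions on the supercircle `S^{1|2}`:
quadruples `f = (f₀, f₁, f₂, f₁₂)` of functions `ℝ → ℝ`, thought of as
`f = f₀ + θ₁f₁ + θ₂f₂ + θ₁θ₂f₁₂` with Grassmann relations
`θ₁θ₂ = −θ₂θ₁`, `θ₁² = θ₂² = 0`. -/
abbrev SF : Type := (ℝ → ℝ) × (ℝ → ℝ) × (ℝ → ℝ) × (ℝ → ℝ)

namespace SF

/-- the coefficient `f₀`. -/
def c0 (f : SF) : ℝ → ℝ := f.1
/-- the coefficient `f₁` of `θ₁`. -/
def c1 (f : SF) : ℝ → ℝ := f.2.1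
/-- the coefficient `f₂` of `θ₂`. -/
def c2 (f : SF) : ℝ → ℝ := f.2.2.1
/-- the coefficient `f₁₂` of `θ₁θ₂`. -/
def c12 (f : SF) : ℝ → ℝ := f.2.2.2

/-- a superfunction is smooth if its four components are. -/
def Smooth (f : SF) : Prop :=
  ContDiff ℝ (⊤ : ℕ∞) f.c0 ∧ ContDiff ℝ (⊤ : ℕ∞) f.c1 ∧
    ContDiff ℝ (⊤ : ℕ∞) f.c2 ∧ ContDiff ℝ (⊤ : ℕ∞) f.c12

/-- the associative product
`(f₀+θ₁f₁+θ₂f₂+θ₁θ₂f₁₂)(g₀+θ₁g₁+θ₂g₂+θ₁θ₂g₁₂)` determined by the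
Grassmann relations `θ₁θ₂ = −θ₂θ₁`, `θ₁² = θ₂² = 0`. -/
def mul (f g : SF) : SF :=
  (f.c0 * g.c0,
   f.c0 * g.c1 + f.c1 * g.c0,
   f.c0 * g.c2 + f.c2 * g.c0,
   f.c0 * g.c12 + f.c12 * g.c0 + f.c1 * g.c2 - f.c2 * g.c1)

/-- `∂ₓ` differentiates each component. -/
noncomputable def dx (f : SF) : SF := (deriv f.c0, deriv f.c1, deriv f.c2, deriv f.c12)

/-- `∂_{θ₁} f = f₁ + θ₂ f₁₂`. -/
def dθ1 (f : SF) : SF := (f.c1, 0, f.c12, 0)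

/-- `∂_{θ₂} f = f₂ − θ₁ f₁₂`. -/
def dθ2 (f : SF) : SF := (f.c2, -f.c12, 0, 0)

/-- the odd coordinate `θ₁` as a superfunction. -/
def θ1 : SF := (0, 1, 0, 0)
/-- the odd coordinate `θ₂` as a superfunction. -/
def θ2 : SF := (0, 0, 1, 0)

/-- `D̄₁ = ∂_{θ₁} − θ₁ ∂ₓ`. -/
noncomputable def D1 (f : SF) : SF := dθ1 f - mul θ1 (dx f)

/-- `D̄₂ = ∂_{θ₂} − θ₂ ∂ₓ`. -/
noncomputable def D2 (f : SF) : SF := dθ2 f - mul θ2 (dx f)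

/-- the contact vector field `X_f = f ∂ₓ − (−1)^{f̃} (1/2)(D̄₁(f) D̄₁ + D̄₂(f) D̄₂)`
of a homogeneous contact Hamiltonian `f` of parity `ε`. -/
noncomputable def X (ε : ℕ) (f : SF) (g : SF) : SF :=
  mul f (dx g) -
    ((-1 : ℝ) ^ ε * (1 / 2 : ℝ)) • (mul (D1 f) (D1 g) + mul (D2 f) (D2 g))

/-- `f` is even: `f₁ = f₂ = 0`. -/
def IsEven (f : SF) : Prop := f.c1 = 0 ∧ f.c2 = 0

/-- `f` is odd: `f₀ = f₁₂ = 0`. -/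
def IsOdd (f : SF) : Prop := f.c0 = 0 ∧ f.c12 = 0

/-- `f` is homogeneous of parity `ε`. -/
def Homog (ε : ℕ) (f : SF) : Prop := if ε % 2 = 0 then IsEven f else IsOdd f

/-- the contact Hamiltonian `1`. -/
def hOne : SF := (1, 0, 0, 0)
/-- the contact Hamiltonian `x`. -/
def hX : SF := (fun x => x, 0, 0, 0)
/-- the contact Hamiltonian `θ₁`. -/
def hθ1 : SF := θ1
/-- the contact Hamiltonian `θ₂`. -/
def hθ2 : SF := θ2
/-- the contact Hamiltonian `θ₁θ₂`. -/
def hθ1θ2 : SF := (0, 0, 0, 1)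
/-- the contact Hamiltonian `x²`. -/
def hX2 : SF := (fun x => x ^ 2, 0, 0, 0)
/-- the contact Hamiltonian `xθ₁`. -/
def hXθ1 : SF := (0, fun x => x, 0, 0)
/-- the contact Hamiltonian `xθ₂`. -/
def hXθ2 : SF := (0, 0, fun x => x, 0)

end SF

namespace SF

theorem Smooth.add {f g : SF} (hf : Smooth f) (hg : Smooth g) : Smooth (f + g) :=
  ⟨hf.1.add hg.1, hf.2.1.add hg.2.1, hf.2.2.1.add hg.2.2.1, hf.2.2.2.add hg.2.2.2⟩

theorem Smooth.sub {f g : SF} (hf : Smooth f) (hg : Smooth g) : Smooth (f - g) :=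
  ⟨hf.1.sub hg.1, hf.2.1.sub hg.2.1, hf.2.2.1.sub hg.2.2.1, hf.2.2.2.sub hg.2.2.2⟩

theorem Smooth.smul {f : SF} (c : ℝ) (hf : Smooth f) : Smooth (c • f) :=
  ⟨hf.1.const_smul c, hf.2.1.const_smul c, hf.2.2.1.const_smul c, hf.2.2.2.const_smul c⟩

theorem Smooth.mul {f g : SF} (hf : Smooth f) (hg : Smooth g) : Smooth (mul f g) := by
  obtain ⟨f0, f1, f2, f3⟩ := hf
  obtain ⟨g0, g1, g2, g3⟩ := hg
  exact ⟨f0.mul g0, (f0.mul g1).add (f1.mul g0), (f0.mul g2).add (f2.mul g0),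
    (((f0.mul g3).add (f3.mul g0)).add (f1.mul g2)).sub (f2.mul g1)⟩

theorem Smooth.dx {f : SF} (hf : Smooth f) : Smooth (dx f) := by
  have key : ∀ u : ℝ → ℝ, ContDiff ℝ (⊤ : ℕ∞) u → ContDiff ℝ (⊤ : ℕ∞) (deriv u) :=
    fun u hu => (contDiff_infty_iff_deriv.mp hu).2
  exact ⟨key _ hf.1, key _ hf.2.1, key _ hf.2.2.1, key _ hf.2.2.2⟩

theorem Smooth.iterate_dx {f : SF} (hf : Smooth f) (n : ℕ) : Smooth (SF.dx^[n] f) := by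
  induction n with
  | zero => exact hf
  | succ n ih => rw [Function.iterate_succ_apply']; exact ih.dx

theorem smooth_θ1 : Smooth θ1 :=
  ⟨contDiff_const, contDiff_const, contDiff_const, contDiff_const⟩

theorem smooth_θ2 : Smooth θ2 :=
  ⟨contDiff_const, contDiff_const, contDiff_const, contDiff_const⟩

theorem Smooth.dθ1 {f : SF} (hf : Smooth f) : Smooth (dθ1 f) :=
  ⟨hf.2.1, contDiff_const, hf.2.2.2, contDiff_const⟩

theorem Smooth.dθ2 {f : SF} (hf : Smooth f) : Smooth (dθ2 f) :=
  ⟨hf.2.2.1, hf.2.2.2.neg, contDiff_const, contDiff_const⟩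

theorem Smooth.D1 {f : SF} (hf : Smooth f) : Smooth (D1 f) :=
  hf.dθ1.sub (smooth_θ1.mul hf.dx)

theorem Smooth.D2 {f : SF} (hf : Smooth f) : Smooth (D2 f) :=
  hf.dθ2.sub (smooth_θ2.mul hf.dx)

theorem Smooth.differentiable {f : SF} (hf : Smooth f) :
    Differentiable ℝ f.c0 ∧ Differentiable ℝ f.c1 ∧ Differentiable ℝ f.c2 ∧
      Differentiable ℝ f.c12 :=
  ⟨hf.1.differentiable (by simp), hf.2.1.differentiable (by simp),
    hf.2.2.1.differentiable (by simp), hf.2.2.2.differentiable (by simp)⟩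

theorem dx_add {f g : SF} (hf : Smooth f) (hg : Smooth g) : dx (f + g) = dx f + dx g := by
  obtain ⟨f0, f1, f2, f3⟩ := hf.differentiable
  obtain ⟨g0, g1, g2, g3⟩ := hg.differentiable
  refine Prod.ext ?_ (Prod.ext ?_ (Prod.ext ?_ ?_)) <;> funext x
  exacts [deriv_add (f0 x) (g0 x), deriv_add (f1 x) (g1 x), deriv_add (f2 x) (g2 x),
    deriv_add (f3 x) (g3 x)]

theorem dx_smul {f : SF} (c : ℝ) (hf : Smooth f) : dx (c • f) = c • dx f := by
  obtain ⟨f0, f1, f2, f3⟩ := hf.differentiable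
  refine Prod.ext ?_ (Prod.ext ?_ (Prod.ext ?_ ?_)) <;> funext x
  exacts [deriv_const_smul c (f0 x), deriv_const_smul c (f1 x), deriv_const_smul c (f2 x),
    deriv_const_smul c (f3 x)]

theorem dx_sub {f g : SF} (hf : Smooth f) (hg : Smooth g) : dx (f - g) = dx f - dx g := by
  have h : f - g = f + (-1 : ℝ) • g := by module
  rw [h, dx_add hf (hg.smul _), dx_smul _ hg]
  module

theorem dx_mul {f g : SF} (hf : Smooth f) (hg : Smooth g) :
    dx (mul f g) = mul (dx f) g + mul f (dx g) := by
  obtain ⟨f0, f1, f2, f3⟩ := hf.differentiable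
  obtain ⟨g0, g1, g2, g3⟩ := hg.differentiable
  have hd := fun {u v : ℝ → ℝ} (hu : Differentiable ℝ u) (hv : Differentiable ℝ v) (x : ℝ) =>
    (hu x).hasDerivAt.mul (hv x).hasDerivAt
  refine Prod.ext ?_ (Prod.ext ?_ (Prod.ext ?_ ?_)) <;> funext x
  · exact (hd f0 g0 x).deriv
  · refine ((hd f0 g1 x).add (hd f1 g0 x)).deriv.trans ?_
    simp only [mul, dx, c0, c1, Prod.fst_add, Prod.snd_add, Pi.add_apply, Pi.mul_apply]
    ring
  · refine ((hd f0 g2 x).add (hd f2 g0 x)).deriv.trans ?_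
    simp only [mul, dx, c0, c2, Prod.fst_add, Prod.snd_add, Pi.add_apply, Pi.mul_apply]
    ring
  · refine ((((hd f0 g3 x).add (hd f3 g0 x)).add (hd f1 g2 x)).sub (hd f2 g1 x)).deriv.trans ?_
    simp only [mul, dx, c0, c1, c2, c12, Prod.snd_add, Pi.add_apply, Pi.sub_apply, Pi.mul_apply]
    ring

theorem iterate_dx_add {f g : SF} (hf : Smooth f) (hg : Smooth g) (n : ℕ) :
    dx^[n] (f + g) = dx^[n] f + dx^[n] g := by
  induction n with
  | zero => rfl
  | succ n ih =>
    simp only [Function.iterate_succ_apply', ih, dx_add (hf.iterate_dx n) (hg.iterate_dx n)]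

theorem iterate_dx_sub {f g : SF} (hf : Smooth f) (hg : Smooth g) (n : ℕ) :
    dx^[n] (f - g) = dx^[n] f - dx^[n] g := by
  induction n with
  | zero => rfl
  | succ n ih =>
    simp only [Function.iterate_succ_apply', ih, dx_sub (hf.iterate_dx n) (hg.iterate_dx n)]

theorem iterate_dx_smul {f : SF} (c : ℝ) (hf : Smooth f) (n : ℕ) :
    dx^[n] (c • f) = c • dx^[n] f := by
  induction n with
  | zero => rfl
  | succ n ih => simp only [Function.iterate_succ_apply', ih, dx_smul c (hf.iterate_dx n)]

theorem zero_mul (g : SF) : mul 0 g = 0 := by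
  simp [mul, c0, c1, c2, c12]

theorem dx_θ1 : dx θ1 = 0 := by
  refine Prod.ext ?_ (Prod.ext ?_ (Prod.ext ?_ ?_)) <;> funext x
  exacts [deriv_const x 0, deriv_const x 1, deriv_const x 0, deriv_const x 0]

theorem dx_θ2 : dx θ2 = 0 := by
  refine Prod.ext ?_ (Prod.ext ?_ (Prod.ext ?_ ?_)) <;> funext x
  exacts [deriv_const x 0, deriv_const x 0, deriv_const x 1, deriv_const x 0]

theorem dx_dθ1 (f : SF) : dx (dθ1 f) = dθ1 (dx f) := by
  refine Prod.ext rfl (Prod.ext ?_ (Prod.ext rfl ?_)) <;> funext x <;> exact deriv_const x 0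

theorem dx_dθ2 (f : SF) : dx (dθ2 f) = dθ2 (dx f) := by
  refine Prod.ext rfl (Prod.ext ?_ (Prod.ext ?_ ?_)) <;> funext x
  exacts [deriv.neg, deriv_const x 0, deriv_const x 0]

theorem dx_D1 {f : SF} (hf : Smooth f) : dx (D1 f) = D1 (dx f) := by
  rw [D1, dx_sub hf.dθ1 (smooth_θ1.mul hf.dx), dx_mul smooth_θ1 hf.dx, dx_θ1, zero_mul, zero_add,
    dx_dθ1, D1]

theorem dx_D2 {f : SF} (hf : Smooth f) : dx (D2 f) = D2 (dx f) := by
  rw [D2, dx_sub hf.dθ2 (smooth_θ2.mul hf.dx), dx_mul smooth_θ2 hf.dx, dx_θ2, zero_mul, zero_add,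
    dx_dθ2, D2]

theorem iterate_dx_D1 {f : SF} (hf : Smooth f) (n : ℕ) : dx^[n] (D1 f) = D1 (dx^[n] f) := by
  induction n with
  | zero => rfl
  | succ n ih => simp only [Function.iterate_succ_apply', ih, dx_D1 (hf.iterate_dx n)]

theorem iterate_dx_D2 {f : SF} (hf : Smooth f) (n : ℕ) : dx^[n] (D2 f) = D2 (dx^[n] f) := by
  induction n with
  | zero => rfl
  | succ n ih => simp only [Function.iterate_succ_apply', ih, dx_D2 (hf.iterate_dx n)]

/-- Leibniz rule for `∂ₓⁿ⁺¹` when the first factor is killed by `∂ₓ²`. -/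
theorem iterate_dx_mul_of_dx_dx_eq_zero {f g : SF} (hf : Smooth f) (hg : Smooth g)
    (h : dx (dx f) = 0) (n : ℕ) :
    dx^[n + 1] (mul f g) =
      mul f (dx^[n + 1] g) + ((n : ℝ) + 1) • mul (dx f) (dx^[n] g) := by
  induction n with
  | zero =>
    simp only [zero_add, Function.iterate_one, Function.iterate_zero, id, dx_mul hf hg]
    push_cast
    module
  | succ n ih =>
    have h0 := hg.iterate_dx n
    have h1 := hg.iterate_dx (n + 1)
    rw [Function.iterate_succ_apply', ih, dx_add (hf.mul h1) ((hf.dx.mul h0).smul _),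
      dx_smul _ (hf.dx.mul h0), dx_mul hf h1, dx_mul hf.dx h0, h, zero_mul,
      ← Function.iterate_succ_apply' dx, ← Function.iterate_succ_apply' dx]
    push_cast
    module

/-- Leibniz rule for `∂ₓⁿ⁺¹` when the first factor is killed by `∂ₓ³` and the second
one is a derivative. -/
theorem iterate_dx_mul_dx_of_dx_dx_dx_eq_zero {f g : SF} (hf : Smooth f) (hg : Smooth g)
    (h : dx (dx (dx f)) = 0) (n : ℕ) :
    dx^[n + 1] (mul f (dx g)) =
      mul f (dx^[n + 2] g) + ((n : ℝ) + 1) • mul (dx f) (dx^[n + 1] g) +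
        (((n : ℝ) + 1) * n / 2) • mul (dx (dx f)) (dx^[n] g) := by
  induction n with
  | zero =>
    simp only [zero_add, Function.iterate_succ_apply', Function.iterate_zero,
      id, dx_mul hf hg.dx]
    push_cast
    module
  | succ n ih =>
    have h0 := hg.iterate_dx n
    have h1 := hg.iterate_dx (n + 1)
    have h2 := hg.iterate_dx (n + 2)
    rw [Function.iterate_succ_apply', ih,
      dx_add ((hf.mul h2).add ((hf.dx.mul h1).smul _)) ((hf.dx.dx.mul h0).smul _),
      dx_add (hf.mul h2) ((hf.dx.mul h1).smul _),
      dx_smul _ (hf.dx.mul h1), dx_smul _ (hf.dx.dx.mul h0), dx_mul hf h2, dx_mul hf.dx h1,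
      dx_mul hf.dx.dx h0, h, zero_mul, ← Function.iterate_succ_apply' dx,
      ← Function.iterate_succ_apply' dx, ← Function.iterate_succ_apply' dx]
    push_cast
    module

theorem X_iterate_dx_sub_iterate_dx_X (ε : ℕ) {f g : SF} (hf : Smooth f) (hg : Smooth g)
    (h : dx (dx (dx f)) = 0) (h1 : D1 (dx (dx f)) = 0) (h2 : D2 (dx (dx f)) = 0) (n : ℕ) :
    X ε f (dx^[n + 1] g) - dx^[n + 1] (X ε f g) =
      -((n : ℝ) + 1) • mul (dx f) (dx^[n + 1] g) +
      (((n : ℝ) + 1) * (-1 : ℝ) ^ ε / 2) •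
        (mul (D1 (dx f)) (dx^[n] (D1 g)) + mul (D2 (dx f)) (dx^[n] (D2 g))) -
      (((n : ℝ) + 1) * n / 2) • mul (dx (dx f)) (dx^[n] g) := by
  have k1 : dx (dx (D1 f)) = 0 := by rw [dx_D1 hf, dx_D1 hf.dx, h1]
  have k2 : dx (dx (D2 f)) = 0 := by rw [dx_D2 hf, dx_D2 hf.dx, h2]
  have s1 := hf.D1.mul hg.D1
  have s2 := hf.D2.mul hg.D2
  rw [X, X, iterate_dx_sub (hf.mul hg.dx) ((s1.add s2).smul _), iterate_dx_smul _ (s1.add s2),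
    iterate_dx_add s1 s2, iterate_dx_mul_dx_of_dx_dx_dx_eq_zero hf hg h,
    iterate_dx_mul_of_dx_dx_eq_zero hf.D1 hg.D1 k1, iterate_dx_mul_of_dx_dx_eq_zero hf.D2 hg.D2 k2,
    ← iterate_dx_D1 hg, ← iterate_dx_D2 hg, dx_D1 hf, dx_D2 hf,
    ← Function.iterate_succ_apply' dx]
  module

/-- A superfunction with quadratic component `f₀` and affine other components satisfies the
hypotheses of `X_iterate_dx_sub_iterate_dx_X`. -/
theorem smooth_and_annihilated (a b c p q r s t u : ℝ) {f : SF}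
    (hf : f = (fun x => a * x ^ 2 + b * x + c, fun x => p * x + q, fun x => r * x + s,
      fun x => t * x + u)) :
    Smooth f ∧ dx (dx (dx f)) = 0 ∧ D1 (dx (dx f)) = 0 ∧ D2 (dx (dx f)) = 0 := by
  have hlin : ∀ p q : ℝ, deriv (fun x : ℝ => p * x + q) = fun _ => p := fun p q => by
    funext x
    simp
  have hquad : deriv (fun x : ℝ => a * x ^ 2 + b * x + c) = fun x => (2 * a) * x + b := by
    funext x
    have := ((((hasDerivAt_pow 2 x).const_mul a).add ((hasDerivAt_id x).const_mul b)).add_const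
      c).deriv
    refine this.trans ?_
    simp
    ring
  have hdd : dx (dx f) = (fun _ => 2 * a, 0, 0, 0) := by
    subst hf
    simp only [dx, c0, c1, c2, c12, hquad, hlin, deriv_const']
    rfl
  have hddd : dx (dx (dx f)) = 0 := by
    rw [hdd]
    refine Prod.ext ?_ (Prod.ext ?_ (Prod.ext ?_ ?_)) <;> funext x <;> exact deriv_const x _
  refine ⟨?_, hddd, ?_, ?_⟩
  · subst hf
    refine ⟨?_, ?_, ?_, ?_⟩ <;> simp only [c0, c1, c2, c12] <;> fun_prop
  · rw [D1, hddd, hdd]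
    simp [dθ1, mul, c0, c1, c2, c12]
  · rw [D2, hddd, hdd]
    simp [dθ2, mul, c0, c1, c2, c12]

end SF

open SF in
/-- For each of the eight contact Hamiltonians `f` (with its parity `ε`) and every `k ≥ 1`,
`[X_f, ∂ₓ^k] = −k f′ ∂ₓ^k + (k(−1)^{f̃}/2)(D̄₁(f′) ∂ₓ^{k−1} D̄₁ + D̄₂(f′) ∂ₓ^{k−1} D̄₂)
− (k(k−1)/2) f″ ∂ₓ^{k−1}` as operators on `A` (ordinary commutator, `∂ₓ^k` being even). -/
theorem commutator_X_dx_pow (f : SF) (ε : ℕ)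
    (hf : (f, ε) = (hOne, 0) ∨ (f, ε) = (hX, 0) ∨ (f, ε) = (hθ1, 1) ∨
      (f, ε) = (hθ2, 1) ∨ (f, ε) = (hθ1θ2, 0) ∨ (f, ε) = (hX2, 0) ∨
      (f, ε) = (hXθ1, 1) ∨ (f, ε) = (hXθ2, 1)) :
    ∀ k : ℕ, 1 ≤ k → ∀ g : SF, Smooth g →
      X ε f (dx^[k] g) - dx^[k] (X ε f g) =
        -((k : ℝ)) • mul (dx f) (dx^[k] g) +
        ((k : ℝ) * (-1 : ℝ) ^ ε / 2) •
          (mul (D1 (dx f)) (dx^[k - 1] (D1 g)) + mul (D2 (dx f)) (dx^[k - 1] (D2 g))) -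
        ((k : ℝ) * ((k : ℝ) - 1) / 2) • mul (dx (dx f)) (dx^[k - 1] g) := by
  have key : Smooth f ∧ dx (dx (dx f)) = 0 ∧ D1 (dx (dx f)) = 0 ∧ D2 (dx (dx f)) = 0 := by
    simp only [Prod.mk.injEq] at hf
    rcases hf with ⟨rfl, -⟩ | ⟨rfl, -⟩ | ⟨rfl, -⟩ | ⟨rfl, -⟩ | ⟨rfl, -⟩ | ⟨rfl, -⟩ | ⟨rfl, -⟩ |
      ⟨rfl, -⟩
    · exact smooth_and_annihilated 0 0 1 0 0 0 0 0 0 (by ext <;> simp [hOne])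
    · exact smooth_and_annihilated 0 1 0 0 0 0 0 0 0 (by ext <;> simp [hX])
    · exact smooth_and_annihilated 0 0 0 0 1 0 0 0 0 (by ext <;> simp [hθ1, θ1])
    · exact smooth_and_annihilated 0 0 0 0 0 0 1 0 0 (by ext <;> simp [hθ2, θ2])
    · exact smooth_and_annihilated 0 0 0 0 0 0 0 0 1 (by ext <;> simp [hθ1θ2])
    · exact smooth_and_annihilated 1 0 0 0 0 0 0 0 0 (by ext <;> simp [hX2])
    · exact smooth_and_annihilated 0 0 0 1 0 0 0 0 0 (by ext <;> simp [hXθ1])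
    · exact smooth_and_annihilated 0 0 0 0 0 1 0 0 0 (by ext <;> simp [hXθ2])
  obtain ⟨hs, h, h1, h2⟩ := key
  intro k hk g hg
  obtain ⟨n, rfl⟩ := Nat.exists_eq_add_of_le' hk
  simpa using X_iterate_dx_sub_iterate_dx_X ε hs hg h h1 h2 n
end

section
/- For all homogeneous f, g ∈ A of parities f̃, g̃, the supercommutator of the corresponding contact vector fields is again a contact vector field with Hamiltonian given by the contact bracket: X_f ∘ X_g − (−1)^{f̃ g̃} X_g ∘ X_f = X_{{f,g}}, where {f,g} = f g′ − f′ g − (−1)^{f̃}(1/2)(D̄₁(f) D̄₁(g) + D̄₂(f) D̄₂(g)) and f′ = ∂ₓ(f). -/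
namespace SF

/-- the contact bracket
`{f,g} = f g′ − f′ g − (−1)^{f̃}(1/2)(D̄₁(f) D̄₁(g) + D̄₂(f) D̄₂(g))`,
for `f` homogeneous of parity `ε`. -/
noncomputable def contactBracket (ε : ℕ) (f g : SF) : SF :=
  mul f (dx g) - mul (dx f) g -
    ((-1 : ℝ) ^ ε * (1 / 2 : ℝ)) • (mul (D1 f) (D1 g) + mul (D2 f) (D2 g))

end SF

theorem ContDiff.differentiable_and_differentiable_deriv {u : ℝ → ℝ}
    (hu : ContDiff ℝ (⊤ : ℕ∞) u) : Differentiable ℝ u ∧ Differentiable ℝ (deriv u) :=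
  ⟨hu.differentiable (by simp), (contDiff_infty_iff_deriv.1 hu).2.differentiable (by simp)⟩

namespace SF

/-- The components of a smooth superfunction are twice differentiable. -/
theorem Smooth.differentiable_s15 {a b c d : ℝ → ℝ} (hf : Smooth (a, b, c, d)) :
    (Differentiable ℝ a ∧ Differentiable ℝ (deriv a)) ∧
      (Differentiable ℝ b ∧ Differentiable ℝ (deriv b)) ∧
      (Differentiable ℝ c ∧ Differentiable ℝ (deriv c)) ∧
      (Differentiable ℝ d ∧ Differentiable ℝ (deriv d)) :=
  ⟨hf.1.differentiable_and_differentiable_deriv,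
    hf.2.1.differentiable_and_differentiable_deriv,
    hf.2.2.1.differentiable_and_differentiable_deriv,
    hf.2.2.2.differentiable_and_differentiable_deriv⟩

theorem Homog.sign_cases {ε : ℕ} {f : SF} (hf : Homog ε f) :
    ((-1 : ℝ) ^ ε = 1 ∧ f.c1 = 0 ∧ f.c2 = 0) ∨ ((-1 : ℝ) ^ ε = -1 ∧ f.c0 = 0 ∧ f.c12 = 0) := by
  unfold Homog at hf
  split_ifs at hf with hε
  · exact Or.inl ⟨(Nat.even_iff.2 hε).neg_one_pow, hf⟩
  · exact Or.inr ⟨(Nat.not_even_iff_odd.1 (mt Nat.even_iff.1 hε)).neg_one_pow, hf⟩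

end SF

set_option maxHeartbeats 1000000 in
open SF in
/-- For all smooth homogeneous `f, g ∈ A` of parities `f̃, g̃`,
`X_f ∘ X_g − (−1)^{f̃g̃} X_g ∘ X_f = X_{{f,g}}` as operators on `A`,
where `{f,g}` is the contact bracket (homogeneous of parity `f̃ + g̃`). -/
theorem supercommutator_X_eq_X_contactBracket
    (εf εg : ℕ) (f g : SF) (hf : Smooth f) (hg : Smooth g)
    (hfh : Homog εf f) (hgh : Homog εg g) :
    ∀ h : SF, Smooth h →
      X εf f (X εg g h) - ((-1 : ℝ) ^ (εf * εg)) • X εg g (X εf f h) =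
        X (εf + εg) (contactBracket εf f g) h := by
  intro h hh
  obtain ⟨f0, f1, f2, f3⟩ := f
  obtain ⟨g0, g1, g2, g3⟩ := g
  obtain ⟨h0, h1, h2, h3⟩ := h
  obtain ⟨⟨hf0, hf0'⟩, ⟨hf1, hf1'⟩, ⟨hf2, hf2'⟩, ⟨hf3, hf3'⟩⟩ :=
    hf.differentiable_s15
  obtain ⟨⟨hg0, hg0'⟩, ⟨hg1, hg1'⟩, ⟨hg2, hg2'⟩, ⟨hg3, hg3'⟩⟩ :=
    hg.differentiable_s15
  obtain ⟨⟨hh0, hh0'⟩, ⟨hh1, hh1'⟩, ⟨hh2, hh2'⟩, ⟨hh3, hh3'⟩⟩ :=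
    hh.differentiable_s15
  rw [pow_mul]
  rcases hfh.sign_cases with ⟨sf, hf1z, hf2z⟩ | ⟨sf, hf1z, hf2z⟩ <;>
  rcases hgh.sign_cases with ⟨sg, hg1z, hg2z⟩ | ⟨sg, hg1z, hg2z⟩ <;>
  simp only [c0, c1, c2, c12] at hf1z hf2z hg1z hg2z <;>
  subst hf1z hf2z hg1z hg2z <;>
  refine Prod.ext ?_ (Prod.ext ?_ (Prod.ext ?_ ?_)) <;>
  ext x <;>
  simp (disch := fun_prop) [X, contactBracket, D1, D2, dx, mul, dθ1, dθ2, θ1, θ2, c0, c1, c2, c12,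
    pow_add, sf, sg, deriv_add, deriv_sub, deriv_mul, deriv_const_smul] <;>
  ring
end

section
/- For every ν ∈ ℝ, writing L_f := X_f + ν f′ (f′ = ∂ₓ(f) acting by left multiplication) for the weight-ν action of the contact Hamiltonians, the Casimir combination −(1/2)L_{x²}∘L_1 − L_{xθ₁}∘L_{θ₁} − L_{xθ₂}∘L_{θ₂} + L_x∘L_x + L_{θ₁θ₂}∘L_{θ₁θ₂} + L_{θ₁}∘L_{xθ₁} + L_{θ₂}∘L_{xθ₂} − (1/2)L_1∘L_{x²} equals ν² · Id as an operator on A. (Applied with ν = δ − k, this says the Casimir operator of spo(2|2) acts on the symbol space of integer degree k as α_k = (δ − k)² times the identity.) -/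
namespace SF

/-- the weight-`ν` action `L_f = X_f + ν f′` of a homogeneous contact Hamiltonian `f`
of parity `ε` (with `f′ = ∂ₓ(f)` acting by left multiplication). -/
noncomputable def L (ε : ℕ) (f : SF) (ν : ℝ) (g : SF) : SF :=
  X ε f g + ν • mul (dx f) g

end SF

namespace SF

/-- The action of an even Hamiltonian depending on `x` alone. -/
theorem L_even (a : ℝ → ℝ) (ν : ℝ) (g : SF) :
    L 0 (a, 0, 0, 0) ν g =
      (fun x => a x * deriv g.c0 x + ν * deriv a x * g.c0 x,
       fun x => a x * deriv g.c1 x + (ν + 1 / 2) * deriv a x * g.c1 x,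
       fun x => a x * deriv g.c2 x + (ν + 1 / 2) * deriv a x * g.c2 x,
       fun x => a x * deriv g.c12 x + (ν + 1) * deriv a x * g.c12 x) := by
  ext x <;> simp [L, X, D1, D2, dx, mul, dθ1, dθ2, θ1, θ2, c0, c1, c2, c12] <;> ring

/-- The action of the Hamiltonian `θ₁θ₂`. -/
theorem L_hθ1θ2 (ν : ℝ) (g : SF) :
    L 0 hθ1θ2 ν g = (0, fun x => 1 / 2 * g.c2 x, fun x => -(1 / 2) * g.c1 x, 0) := by
  ext x <;>
    simp [L, X, D1, D2, dx, mul, dθ1, dθ2, θ1, θ2, hθ1θ2, c0, c1, c2, c12] <;> ring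

/-- The action of an odd Hamiltonian `θ₁b` with `b` depending on `x` alone. -/
theorem L_odd_θ1 (b : ℝ → ℝ) (ν : ℝ) (g : SF) :
    L 1 (0, b, 0, 0) ν g =
      (fun x => 1 / 2 * b x * g.c1 x,
       fun x => 1 / 2 * b x * deriv g.c0 x + ν * deriv b x * g.c0 x,
       fun x => 1 / 2 * b x * g.c12 x,
       fun x => 1 / 2 * b x * deriv g.c2 x + (ν + 1 / 2) * deriv b x * g.c2 x) := by
  ext x <;> simp [L, X, D1, D2, dx, mul, dθ1, dθ2, θ1, θ2, c0, c1, c2, c12] <;> ring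

/-- The action of an odd Hamiltonian `θ₂b` with `b` depending on `x` alone. -/
theorem L_odd_θ2 (b : ℝ → ℝ) (ν : ℝ) (g : SF) :
    L 1 (0, 0, b, 0) ν g =
      (fun x => 1 / 2 * b x * g.c2 x,
       fun x => -(1 / 2) * b x * g.c12 x,
       fun x => 1 / 2 * b x * deriv g.c0 x + ν * deriv b x * g.c0 x,
       fun x => -(1 / 2) * b x * deriv g.c1 x - (ν + 1 / 2) * deriv b x * g.c1 x) := by
  ext x <;> simp [L, X, D1, D2, dx, mul, dθ1, dθ2, θ1, θ2, c0, c1, c2, c12] <;> ring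

end SF

open SF in
/-- The Casimir combination
`−(1/2)L_{x²}∘L_1 − L_{xθ₁}∘L_{θ₁} − L_{xθ₂}∘L_{θ₂} + L_x∘L_x + L_{θ₁θ₂}∘L_{θ₁θ₂}
+ L_{θ₁}∘L_{xθ₁} + L_{θ₂}∘L_{xθ₂} − (1/2)L_1∘L_{x²}` of the weight-`ν` actions equals
`ν² · Id` as an operator on `A`. -/
theorem casimir_on_densities (ν : ℝ) :
    ∀ g : SF, Smooth g →
      -((1 / 2 : ℝ)) • L 0 hX2 ν (L 0 hOne ν g) -
        L 1 hXθ1 ν (L 1 hθ1 ν g) -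
        L 1 hXθ2 ν (L 1 hθ2 ν g) +
        L 0 hX ν (L 0 hX ν g) +
        L 0 hθ1θ2 ν (L 0 hθ1θ2 ν g) +
        L 1 hθ1 ν (L 1 hXθ1 ν g) +
        L 1 hθ2 ν (L 1 hXθ2 ν g) -
        (1 / 2 : ℝ) • L 0 hOne ν (L 0 hX2 ν g) =
      (ν ^ 2) • g := by
  rintro ⟨g₀, g₁, g₂, g₁₂⟩ ⟨h₀, h₁, h₂, h₁₂⟩
  have differentiable_of_smooth {u : ℝ → ℝ} (hu : ContDiff ℝ (⊤ : ℕ∞) u) :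
      Differentiable ℝ u ∧ Differentiable ℝ (deriv u) :=
    ⟨hu.differentiable (by simp),
      (contDiff_infty_iff_deriv.mp hu).2.differentiable (by simp)⟩
  simp only [c0, c1, c2, c12] at h₀ h₁ h₂ h₁₂
  obtain ⟨d₀, d₀'⟩ := differentiable_of_smooth h₀
  obtain ⟨d₁, d₁'⟩ := differentiable_of_smooth h₁
  obtain ⟨d₂, d₂'⟩ := differentiable_of_smooth h₂
  obtain ⟨d₁₂, d₁₂'⟩ := differentiable_of_smooth h₁₂
  simp only [L_hθ1θ2, hX2, hOne, hX, hθ1, hθ2, hXθ1, hXθ2, θ1, θ2, L_even, L_odd_θ1, L_odd_θ2,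
    c0, c1, c2, c12]
  ext x <;>
    simp (disch := fun_prop) [deriv_fun_add, deriv_fun_mul] <;>
    ring
end
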